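/- Let 𝐀 be a BBL transformation of bandwidth (p,q) on V_d^S with p ≤ 0 ≤ q and with both leading coefficients a_p and a_q invertible in M_d(ℂ). Then for all finite integers L ≤ R with R − L ≥ τ = q − p, the bulk solution space equals the projected kernel: M_{L,R} = P_{L,R} Ker 𝐀. -/

import Mathlib

noncomputable section

/-- The space of doubly-infinite sequences with values in `ℂ^d`. -/
abbrev SeqSp (d : ℕ) : Type := ℤ → Fin d → ℂ

/-- The shift `(Ψ_j)_j ↦ (Ψ_{j+n})_j`; for `n = 1` this is the left shift `T`. -/
def shiftBy (d : ℕ) (n : ℤ) : Module.End ℂ (SeqSp d) where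
  toFun Ψ := fun j => Ψ (j + n)
  map_add' _ _ := rfl
  map_smul' _ _ := rfl

/-- Entrywise multiplication of a sequence by a fixed `d × d` matrix. -/
def matOp (d : ℕ) (m : Matrix (Fin d) (Fin d) ℂ) : Module.End ℂ (SeqSp d) where
  toFun Ψ := fun j => m.mulVec (Ψ j)
  map_add' Ψ Φ := by funext j; simp [Matrix.mulVec_add]
  map_smul' c Ψ := by funext j; simp [Matrix.mulVec_smul]

/-- The banded block-Laurent (BBL) transformation `(𝐀Ψ)_j = ∑_{r=p}^{q} a_r ψ_{j+r}`. -/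
def bbl (d : ℕ) (a : ℤ → Matrix (Fin d) (Fin d) ℂ) (p q : ℤ) : Module.End ℂ (SeqSp d) :=
  ∑ r ∈ Finset.Icc p q, matOp d (a r) * shiftBy d r

/-- The projection `P_S` replacing every entry with index outside `S` by zero. -/
def projOn (d : ℕ) (S : Set ℤ) : Module.End ℂ (SeqSp d) where
  toFun Ψ := fun j => S.indicator Ψ j
  map_add' Ψ Φ := by
    funext j
    by_cases h : j ∈ S <;> simp [Set.indicator_apply, h]
  map_smul' c Ψ := by
    funext j
    by_cases h : j ∈ S <;> simp [Set.indicator_apply, h]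

/-- The window `{j : ℤ | Lb ≤ j ≤ Rb}`, with possibly infinite endpoints. -/
def windowSet (Lb : WithBot ℤ) (Rb : WithTop ℤ) : Set ℤ :=
  {j : ℤ | Lb ≤ (j : WithBot ℤ) ∧ (j : WithTop ℤ) ≤ Rb}

/-- Sequences supported in `S` (vanishing at every index outside `S`): the space `V_{L,R}`. -/
def suppIn (d : ℕ) (S : Set ℤ) : Submodule ℂ (SeqSp d) where
  carrier := {Ψ | ∀ j ∉ S, Ψ j = 0}
  add_mem' := by
    intro Ψ Φ hΨ hΦ j hj
    simp [Pi.add_apply, hΨ j hj, hΦ j hj]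
  zero_mem' := fun j _ => rfl
  smul_mem' := by
    intro c Ψ hΨ j hj
    simp [Pi.smul_apply, hΨ j hj]

/-- Sequences vanishing at every index of `S`. -/
def vanishOn (d : ℕ) (S : Set ℤ) : Submodule ℂ (SeqSp d) where
  carrier := {Ψ | ∀ j ∈ S, Ψ j = 0}
  add_mem' := by
    intro Ψ Φ hΨ hΦ j hj
    simp [Pi.add_apply, hΨ j hj, hΦ j hj]
  zero_mem' := fun j _ => rfl
  smul_mem' := by
    intro c Ψ hΨ j hj
    simp [Pi.smul_apply, hΨ j hj]

/-- The bulk solution space `M_{Lb,Rb} = Ker (P_{Lb−p',Rb−q'} 𝐀 |_{V_{Lb,Rb}})`, viewed as a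
submodule of the full sequence space: sequences supported in the window `[Lb,Rb]` whose image
under `𝐀` vanishes on the bulk window `[Lb−p', Rb−q']` (with `p' = min p 0`, `q' = max q 0`). -/
def bulkSol (d : ℕ) (a : ℤ → Matrix (Fin d) (Fin d) ℂ) (p q : ℤ)
    (Lb : WithBot ℤ) (Rb : WithTop ℤ) : Submodule ℂ (SeqSp d) :=
  suppIn d (windowSet Lb Rb) ⊓
    (vanishOn d (windowSet (Lb + ((-min p 0 : ℤ) : WithBot ℤ))
        (Rb + ((-max q 0 : ℤ) : WithTop ℤ)))).comap (bbl d a p q)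

/-- Falling-factorial type product `j^{(v)} = (j−v+1)(j−v+2)⋯j`. -/
def ff (j : ℤ) (v : ℕ) : ℤ := ∏ i ∈ Finset.range v, (j - i)

/-- The scalar sequence `Φ_{z,v}`, with `j`-th entry `j^{(v−1)} z^{j−v+1}`, and `Φ_{z,0} = 0`. -/
def Phi (z : ℂ) (v : ℕ) : ℤ → ℂ :=
  fun j => if v = 0 then 0 else (ff j (v - 1) : ℂ) * z ^ (j - (v : ℤ) + 1)

/-- The vector sequence `Φ_{z,v}|m⟩`. -/
def PhiVec (d : ℕ) (z : ℂ) (v : ℕ) (m : Fin d) : SeqSp d :=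
  fun j => Phi z v j • (Pi.single m 1 : Fin d → ℂ)

/-- The subspace `T_{z,s} = Span{Φ_{z,v}|m⟩ : 1 ≤ v ≤ s, 1 ≤ m ≤ d}`. -/
def Tspace (d : ℕ) (z : ℂ) (s : ℕ) : Submodule ℂ (SeqSp d) :=
  Submodule.span ℂ {Ψ : SeqSp d | ∃ v ∈ Finset.Icc 1 s, ∃ m : Fin d, Ψ = PhiVec d z v m}

/-- The symbol `A(w,w⁻¹) = ∑_{r=p}^q w^r a_r` as a matrix of Laurent polynomials. -/
def symbol (d : ℕ) (a : ℤ → Matrix (Fin d) (Fin d) ℂ) (p q : ℤ) :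
    Matrix (Fin d) (Fin d) (LaurentPolynomial ℂ) :=
  ∑ r ∈ Finset.Icc p q, (LaurentPolynomial.T r : LaurentPolynomial ℂ) • (a r).map (fun c => LaurentPolynomial.C c)

/-- The evaluation `A(z,z⁻¹) = ∑_{r=p}^q z^r a_r` of the symbol at `z ≠ 0`. -/
def symbolEval (d : ℕ) (a : ℤ → Matrix (Fin d) (Fin d) ℂ) (p q : ℤ) (z : ℂ) :
    Matrix (Fin d) (Fin d) ℂ :=
  ∑ r ∈ Finset.Icc p q, z ^ r • a r

/-- The `k`-th derivative `A^{(k)}(z,z⁻¹) = ∑_{r=p}^q r(r−1)⋯(r−k+1) z^{r−k} a_r`. -/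
def symbolDeriv (d : ℕ) (a : ℤ → Matrix (Fin d) (Fin d) ℂ) (p q : ℤ) (k : ℕ) (z : ℂ) :
    Matrix (Fin d) (Fin d) ℂ :=
  ∑ r ∈ Finset.Icc p q, ((ff r k : ℂ) * z ^ (r - (k : ℤ))) • a r

/-- The generalized kernel `⋃_k Ker (f^k)` of an endomorphism. -/
def genKer (d : ℕ) (f : Module.End ℂ (SeqSp d)) : Submodule ℂ (SeqSp d) :=
  ⨆ k : ℕ, LinearMap.ker (f ^ k)

/-- `F_L^− `: the generalized kernel of the unilateral shift `P_{L,∞}T` on `M_{L,∞}`. -/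
def Fminus (d : ℕ) (a : ℤ → Matrix (Fin d) (Fin d) ℂ) (p q : ℤ) (L : ℤ) :
    Submodule ℂ (SeqSp d) :=
  bulkSol d a p q (L : WithBot ℤ) ⊤ ⊓
    genKer d (projOn d (windowSet (L : WithBot ℤ) ⊤) * shiftBy d 1)

/-- `F_R^+`: the generalized kernel of the shift `P_{−∞,R}T⁻¹` on `M_{−∞,R}`. -/
def Fplus (d : ℕ) (a : ℤ → Matrix (Fin d) (Fin d) ℂ) (p q : ℤ) (R : ℤ) :
    Submodule ℂ (SeqSp d) :=
  bulkSol d a p q ⊥ (R : WithTop ℤ) ⊓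
    genKer d (projOn d (windowSet ⊥ (R : WithTop ℤ)) * shiftBy d (-1))

/-- The left shift on scalar sequences. -/
def shiftS : Module.End ℂ (ℤ → ℂ) where
  toFun φ := fun j => φ (j + 1)
  map_add' _ _ := rfl
  map_smul' _ _ := rfl

/-- The linear map on `SeqSp d` induced by a diagonal matrix polynomial with diagonal entries
`g m`: it acts on the `m`-th component of a sequence as `g m` evaluated at the left shift. -/
def diagPolyOp (d : ℕ) (g : Fin d → Polynomial ℂ) : Module.End ℂ (SeqSp d) where
  toFun Ψ := fun j m => Polynomial.aeval shiftS (g m) (fun i => Ψ i m) j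
  map_add' Ψ Φ := by
    funext j m
    show Polynomial.aeval shiftS (g m) ((fun i => Ψ i m) + (fun i => Φ i m)) j = _
    rw [map_add]
    rfl
  map_smul' c Ψ := by
    funext j m
    show Polynomial.aeval shiftS (g m) (c • (fun i => Ψ i m)) j = _
    rw [map_smul]
    rfl

/-- The subspace of sequences with values in `Span{|m⟩ : d₀ < m ≤ d}` (the range of `ρ_d(π)`). -/
def piRange (d d₀ : ℕ) : Submodule ℂ (SeqSp d) where
  carrier := {Ψ | ∀ j : ℤ, ∀ m : Fin d, (m : ℕ) < d₀ → Ψ j m = 0}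
  add_mem' := by
    intro Ψ Φ hΨ hΦ j m hm
    simp [Pi.add_apply, hΨ j m hm, hΦ j m hm]
  zero_mem' := fun j m _ => rfl
  smul_mem' := by
    intro c Ψ hΨ j m hm
    simp [Pi.smul_apply, hΨ j m hm]

/-- The Hilbert space `H` of square-summable half-infinite sequences, as a subspace of `SeqSp d`:
sequences vanishing at indices `j ≤ 0` whose restriction to `j ≥ 1` is in `ℓ²`. -/
def Hspace (d : ℕ) : Submodule ℂ (SeqSp d) where
  carrier := {Ψ | (∀ j : ℤ, j ≤ 0 → Ψ j = 0) ∧ Memℓp (fun n : ℕ => Ψ ((n : ℤ) + 1)) 2}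
  add_mem' := by
    intro Ψ Φ hΨ hΦ
    refine ⟨fun j hj => by simp [Pi.add_apply, hΨ.1 j hj, hΦ.1 j hj], ?_⟩
    exact hΨ.2.add hΦ.2
  zero_mem' := ⟨fun j _ => rfl, zero_memℓp⟩
  smul_mem' := by
    intro c Ψ hΨ
    exact ⟨fun j hj => by simp [Pi.smul_apply, hΨ.1 j hj], hΨ.2.const_smul c⟩

/-- Extension of `Ψ` beyond the index `R` by solving the recursion of the BBL transformation
for its leading entry. -/
def rightExt {d : ℕ} (a : ℤ → Matrix (Fin d) (Fin d) ℂ) (p q R : ℤ) (Ψ : SeqSp d)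
    (j : ℤ) : Fin d → ℂ :=
  if j ≤ R then Ψ j
  else -((a q)⁻¹.mulVec (∑ r ∈ Finset.Ico p q,
    if r < q then (a r).mulVec (rightExt a p q R Ψ (j - q + r)) else 0))
termination_by (j - R).toNat
decreasing_by omega

theorem bbl_apply {d : ℕ} (a : ℤ → Matrix (Fin d) (Fin d) ℂ) (p q : ℤ) (Ψ : SeqSp d) (j : ℤ) :
    bbl d a p q Ψ j = ∑ r ∈ Finset.Icc p q, (a r).mulVec (Ψ (j + r)) := by
  simp [bbl, matOp, shiftBy, LinearMap.sum_apply, Finset.sum_apply]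

theorem mem_windowSet_coe {L R j : ℤ} :
    j ∈ windowSet (L : WithBot ℤ) (R : WithTop ℤ) ↔ L ≤ j ∧ j ≤ R := by
  simp [windowSet]

theorem bbl_apply_congr {d : ℕ} (a : ℤ → Matrix (Fin d) (Fin d) ℂ) {p q : ℤ} {Ψ Φ : SeqSp d}
    {j : ℤ} (h : ∀ i, j + p ≤ i → i ≤ j + q → Ψ i = Φ i) :
    bbl d a p q Ψ j = bbl d a p q Φ j := by
  simp only [bbl_apply]
  refine Finset.sum_congr rfl fun r hr => ?_
  rw [Finset.mem_Icc] at hr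
  rw [h (j + r) (by omega) (by omega)]

theorem exists_right_extension {d : ℕ} {a : ℤ → Matrix (Fin d) (Fin d) ℂ} {p q : ℤ}
    (hpq : p ≤ q) (haq : IsUnit (a q)) (R : ℤ) (Ψ : SeqSp d) :
    ∃ Φ : SeqSp d, (∀ j ≤ R, Φ j = Ψ j) ∧ ∀ j, R < j + q → bbl d a p q Φ j = 0 := by
  refine ⟨rightExt a p q R Ψ, fun j hj => by rw [rightExt, if_pos hj], fun j hj => ?_⟩
  have hdet : IsUnit (a q).det := (Matrix.isUnit_iff_isUnit_det _).mp haq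
  rw [bbl_apply, ← Finset.Ico_insert_right hpq, Finset.sum_insert (by simp),
    rightExt, if_neg (not_le.mpr hj), Matrix.mulVec_neg, Matrix.mulVec_mulVec,
    Matrix.mul_nonsing_inv _ hdet, Matrix.one_mulVec, neg_add_eq_zero]
  refine Finset.sum_congr rfl fun r hr => ?_
  rw [if_pos (Finset.mem_Ico.mp hr).2, add_sub_cancel_right]

theorem exists_left_extension {d : ℕ} {a : ℤ → Matrix (Fin d) (Fin d) ℂ} {p q : ℤ}
    (hpq : p ≤ q) (hap : IsUnit (a p)) (L : ℤ) (Ψ : SeqSp d) :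
    ∃ Φ : SeqSp d, (∀ j, L ≤ j → Φ j = Ψ j) ∧ ∀ j, j + p < L → bbl d a p q Φ j = 0 := by
  obtain ⟨Φ, hΦ, hker⟩ := exists_right_extension (a := fun r => a (-r)) (p := -q) (q := -p)
    (by omega) (by simpa using hap) (-L) (fun j => Ψ (-j))
  refine ⟨fun j => Φ (-j), fun j hj => by simp [hΦ (-j) (by omega)], fun j hj => ?_⟩
  rw [← hker (-j) (by omega), bbl_apply, bbl_apply]
  refine Finset.sum_bij' (fun r _ => -r) (fun r _ => -r) ?_ ?_ ?_ ?_ ?_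
  · intro r hr; rw [Finset.mem_Icc] at *; omega
  · intro r hr; rw [Finset.mem_Icc] at *; omega
  · simp
  · simp
  · intro r _; rw [neg_neg, neg_add]

theorem stmt_2 (d : ℕ) (hd : 1 ≤ d) (p q : ℤ) (hp : p ≤ 0) (hq : 0 ≤ q)
    (a : ℤ → Matrix (Fin d) (Fin d) ℂ) (hap : IsUnit (a p)) (haq : IsUnit (a q))
    (L R : ℤ) (hLR : q - p ≤ R - L) :
    bulkSol d a p q (L : WithBot ℤ) (R : WithTop ℤ)
      = (LinearMap.ker (bbl d a p q)).map
          (projOn d (windowSet (L : WithBot ℤ) (R : WithTop ℤ))) := by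
  have hpq : p ≤ q := hp.trans hq
  have hbulk : ∀ j : ℤ, j ∈ windowSet ((L : WithBot ℤ) + ((-min p 0 : ℤ) : WithBot ℤ))
      ((R : WithTop ℤ) + ((-max q 0 : ℤ) : WithTop ℤ)) ↔ L ≤ j + p ∧ j + q ≤ R := by
    intro j
    rw [min_eq_left hp, max_eq_left hq, ← WithBot.coe_add, ← WithTop.coe_add, mem_windowSet_coe]
    omega
  ext Ψ
  constructor
  · rintro ⟨hsupp, hvanish⟩
    obtain ⟨Φ, hΦ, hΦker⟩ := exists_right_extension hpq haq R Ψ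
    obtain ⟨Χ, hΧ, hΧker⟩ := exists_left_extension hpq hap L Φ
    refine ⟨Χ, ?_, ?_⟩
    · refine LinearMap.mem_ker.mpr (funext fun j => ?_)
      by_cases hl : j + p < L
      · exact hΧker j hl
      rw [bbl_apply_congr a fun i hi _ => hΧ i (by omega)]
      by_cases hr : R < j + q
      · exact hΦker j hr
      rw [bbl_apply_congr a fun i _ hi => hΦ i (by omega)]
      exact hvanish j ((hbulk j).mpr ⟨by omega, by omega⟩)
    · funext j
      by_cases hj : j ∈ windowSet (L : WithBot ℤ) (R : WithTop ℤ)
      · have hj' := mem_windowSet_coe.mp hj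
        simp [projOn, hj, hΧ j hj'.1, hΦ j hj'.2]
      · simp [projOn, hj, hsupp j hj]
  · rintro ⟨Φ, hΦ, rfl⟩
    refine ⟨fun j hj => by simp [projOn, hj], fun j hj => ?_⟩
    have hj' := (hbulk j).mp hj
    rw [bbl_apply_congr (Φ := Φ) a fun i hi hi' => ?_]
    · exact congrFun (LinearMap.mem_ker.mp hΦ) j
    · have : i ∈ windowSet (L : WithBot ℤ) (R : WithTop ℤ) :=
        mem_windowSet_coe.mpr ⟨by omega, by omega⟩
      simp [projOn, this]

end
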